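/- Suppose S = {0,1,2,...} and the chain X has uniformly bounded jumps, i.e. there is an integer M ≥ 1 such that P(i,j) = 0 whenever |i − j| > M. Then β(X) ≤ M, and every set in the Blackwell decomposition for X is atomic. -/

import Mathlib

open MeasureTheory Filter Set ProbabilityTheory

/-- A discrete-time Markov chain on a state space `S`: a stochastic transition
matrix `P`, an initial distribution `init`, and the induced probability measure
`μ` on the path space `ℕ → S`, determined by its values on cylinder sets. -/
structure MarkovChain (S : Type) [MeasurableSpace S] where
  P : S → S → ℝ
  P_nonneg : ∀ i j, 0 ≤ P i j
  P_stochastic : ∀ i, HasSum (P i) 1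
  init : S → ℝ
  init_nonneg : ∀ i, 0 ≤ init i
  init_hasSum : HasSum init 1
  μ : Measure (ℕ → S)
  μ_prob : IsProbabilityMeasure μ
  μ_cylinder : ∀ (n : ℕ) (s : ℕ → S),
    μ {ω | ∀ k ≤ n, ω k = s k}
      = ENNReal.ofReal (init (s 0) * ∏ k ∈ Finset.range n, P (s k) (s (k + 1)))

namespace MarkovChain

variable {S : Type} [MeasurableSpace S]

open Classical in
/-- The `n`-step transition probabilities `P^n(i,j)`. -/
noncomputable def Pn (X : MarkovChain S) : ℕ → S → S → ℝ
  | 0, i, j => if i = j then 1 else 0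
  | n + 1, i, j => ∑' k : S, X.Pn n i k * X.P k j

/-- Irreducibility: every state can be reached from every state. -/
def Irreducible (X : MarkovChain S) : Prop := ∀ i j : S, ∃ n : ℕ, 0 < X.Pn n i j

/-- Aperiodicity: for each state, the gcd of the set `{n ≥ 1 | P^n(i,i) > 0}`
is `1` (expressed via common divisors). -/
def Aperiodic (X : MarkovChain S) : Prop :=
  ∀ i : S, ∀ d : ℕ, (∀ n : ℕ, 0 < n → 0 < X.Pn n i i → d ∣ n) → d = 1

/-- `U^(m)(C)`: the event that the `m`-step chain visits `C` infinitely often. -/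
def U (X : MarkovChain S) (m : ℕ) (C : Set S) : Set (ℕ → S) :=
  {ω | ∀ n : ℕ, ∃ k : ℕ, n ≤ k ∧ ω (k * m) ∈ C}

/-- `L^(m)(C)`: the event that the `m`-step chain is eventually in `C`. -/
def L (X : MarkovChain S) (m : ℕ) (C : Set S) : Set (ℕ → S) :=
  {ω | ∃ n : ℕ, ∀ k : ℕ, n ≤ k → ω (k * m) ∈ C}

/-- `C` is transient with respect to the `m`-step chain `X^(m)`. -/
def Transient (X : MarkovChain S) (m : ℕ) (C : Set S) : Prop := X.μ (X.U m C) = 0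

/-- `C` is regular with respect to `X^(m)`: `U^(m)(C)` and `L^(m)(C)` agree up
to a null event. -/
def Regular (X : MarkovChain S) (m : ℕ) (C : Set S) : Prop :=
  X.μ (symmDiff (X.U m C) (X.L m C)) = 0

/-- `C` is almost closed with respect to `X^(m)`: regular but not transient. -/
def AlmostClosed (X : MarkovChain S) (m : ℕ) (C : Set S) : Prop :=
  X.Regular m C ∧ ¬ X.Transient m C

/-- An almost closed set is atomic if it does not contain two disjoint almost
closed subsets. -/
def Atomic (X : MarkovChain S) (m : ℕ) (C : Set S) : Prop :=
  X.AlmostClosed m C ∧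
    ¬ ∃ A B : Set S, A ⊆ C ∧ B ⊆ C ∧ Disjoint A B ∧
      X.AlmostClosed m A ∧ X.AlmostClosed m B

/-- A Blackwell decomposition for the `m`-step chain `X^(m)`: a countable
collection of pairwise disjoint almost closed sets, all atomic except at most
one, where a nonatomic member contains no atomic subsets and consists of
transient states, and such that the probabilities `μ(L^(m)(C))` sum to one. -/
structure IsBlackwell (X : MarkovChain S) (m : ℕ) (𝒞 : Set (Set S)) : Prop where
  countable : 𝒞.Countable
  almostClosed : ∀ C ∈ 𝒞, X.AlmostClosed m C
  disjoint : 𝒞.PairwiseDisjoint id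
  atMostOneNonatomic : ∀ C₁ ∈ 𝒞, ∀ C₂ ∈ 𝒞, ¬ X.Atomic m C₁ → ¬ X.Atomic m C₂ → C₁ = C₂
  nonatomicNoAtomicSubset : ∀ C ∈ 𝒞, ¬ X.Atomic m C → ∀ A : Set S, A ⊆ C → ¬ X.Atomic m A
  nonatomicTransientStates : ∀ C ∈ 𝒞, ¬ X.Atomic m C → ∀ i ∈ C, X.Transient m {i}
  sum_L_eq_one : ∑' C : 𝒞, X.μ (X.L m (C : Set S)) = 1

/-- `β(X^(m))`: the number of sets in a Blackwell decomposition for `X^(m)`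
(well defined since the decomposition is unique up to equivalence). -/
noncomputable def beta (X : MarkovChain S) (m : ℕ) : ℕ∞ :=
  sInf (Set.encard '' {𝒞 : Set (Set S) | X.IsBlackwell m 𝒞})

/-- `X` is simple if `β(X) = 1`. -/
def Simple (X : MarkovChain S) : Prop := X.beta 1 = 1

/-- The asymptotic period `d(X) = sup {m ≥ 1 | β(X^(m)) = m}` (possibly `∞`). -/
noncomputable def period (X : MarkovChain S) : ℕ∞ :=
  sSup {d : ℕ∞ | ∃ m : ℕ, 1 ≤ m ∧ X.beta m = (m : ℕ∞) ∧ d = (m : ℕ∞)}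

/-- Recurrence: every state is visited infinitely often almost surely. -/
def Recurrent (X : MarkovChain S) : Prop := ∀ i : S, X.μ (X.U 1 {i}) = 1

end MarkovChain

/-- The shift operator `θ` on path space: `(θ ω)(n) = ω(n+1)`. -/
def pathShift {S : Type} : (ℕ → S) → ℕ → S := fun ω n => ω (n + 1)

/-- An event `E` is `m`-invariant if its indicator function `f` satisfies
`f(ω) = f(θ^m ω)` for all paths `ω`. -/
def MInvariant {S : Type} (m : ℕ) (E : Set (ℕ → S)) : Prop :=
  ∀ ω : ℕ → S, ω ∈ E ↔ pathShift^[m] ω ∈ E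

/-- A birth-death process: a Markov chain on `ℕ` with positive birth
probabilities `p_i = P(i,i+1)`, positive death probabilities `q_{i+1} = P(i+1,i)`,
all transition probabilities other than `p_i`, `q_i` and `r_i = P(i,i)` zero,
and at least one positive self-transition probability. -/
structure MarkovChain.IsBirthDeath (X : MarkovChain ℕ) : Prop where
  birth_pos : ∀ i : ℕ, 0 < X.P i (i + 1)
  death_pos : ∀ i : ℕ, 0 < X.P (i + 1) i
  tridiagonal : ∀ i j : ℕ, 1 < |(i : ℤ) - (j : ℤ)| → X.P i j = 0
  self_pos : ∃ i : ℕ, 0 < X.P i i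

namespace MarkovChain

section General

variable {S : Type} [MeasurableSpace S] (X : MarkovChain S)

theorem mem_U_one {C : Set S} {ω : ℕ → S} : ω ∈ X.U 1 C ↔ ∃ᶠ k in atTop, ω k ∈ C := by
  simp [U, frequently_atTop]

theorem mem_L_one {C : Set S} {ω : ℕ → S} : ω ∈ X.L 1 C ↔ ∀ᶠ k in atTop, ω k ∈ C := by
  simp [L, eventually_atTop]

theorem regular_one_iff {C : Set S} :
    X.Regular 1 C ↔
      ∀ᵐ ω ∂X.μ, (∃ᶠ k in atTop, ω k ∈ C) → ∀ᶠ k in atTop, ω k ∈ C := by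
  have h : symmDiff (X.U 1 C) (X.L 1 C) =
      {ω | ¬ ((∃ᶠ k in atTop, ω k ∈ C) → ∀ᶠ k in atTop, ω k ∈ C)} := by
    ext ω
    rw [Set.mem_symmDiff, mem_U_one, mem_L_one, mem_ofPred_eq]
    have := fun h : ∀ᶠ k in atTop, ω k ∈ C => h.frequently
    tauto
  rw [Regular, h, ae_iff]

theorem transient_one_iff {C : Set S} :
    X.Transient 1 C ↔ ∀ᵐ ω ∂X.μ, ∀ᶠ k in atTop, ω k ∉ C := by
  have h : X.U 1 C = {ω | ¬ ∀ᶠ k in atTop, ω k ∉ C} := by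
    ext ω
    rw [mem_U_one, mem_ofPred_eq, Filter.Frequently]
  rw [Transient, h, ae_iff]

theorem measurableSet_L {C : Set S} (hC : MeasurableSet C) (m : ℕ) :
    MeasurableSet (X.L m C) := by
  have h : X.L m C = ⋃ n : ℕ, ⋂ k : ℕ, ⋂ _ : n ≤ k, (fun ω : ℕ → S => ω (k * m)) ⁻¹' C := by
    ext ω
    simp [L]
  rw [h]
  exact .iUnion fun n => .iInter fun k => .iInter fun _ => measurable_pi_apply _ hC

theorem AlmostClosed.nonempty {X : MarkovChain S} {m : ℕ} {C : Set S} (h : X.AlmostClosed m C) :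
    C.Nonempty := by
  by_contra hC
  rw [Set.not_nonempty_iff_eq_empty] at hC
  refine h.2 ?_
  have : X.U m C = ∅ := by
    ext ω
    simp [U, hC]
  rw [Transient, this, measure_empty]

/-- A property closed under one-step transitions is closed under `n`-step transitions. -/
theorem of_Pn_pos {X : MarkovChain S} {p : S → Prop}
    (hp : ∀ i j, p i → 0 < X.P i j → p j) {n : ℕ} {i j : S} (hi : p i) (h : 0 < X.Pn n i j) :
    p j := by
  induction n generalizing j with
  | zero =>
    rw [Pn] at h
    split_ifs at h with hij
    · exact hij ▸ hi
    · exact absurd h (lt_irrefl _)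
  | succ n ih =>
    rw [Pn] at h
    obtain ⟨k, hk⟩ : ∃ k, 0 < X.Pn n i k * X.P k j := by
      by_contra! hk
      exact absurd h (not_lt.2 (tsum_nonpos hk))
    rcases (X.P_nonneg k j).lt_or_eq with hkj | hkj
    · exact hp k j (ih (pos_of_mul_pos_left hk hkj.le)) hkj
    · simp [← hkj] at hk

/-- Almost every path only uses transitions of positive probability. -/
theorem ae_forall_P_pos [Countable S] : ∀ᵐ ω ∂X.μ, ∀ k, 0 < X.P (ω k) (ω (k + 1)) := by
  rw [ae_all_iff]
  intro n
  rw [ae_iff]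
  have hsub : {ω : ℕ → S | ¬ 0 < X.P (ω n) (ω (n + 1))} ⊆
      ⋃ a : {a : Fin (n + 2) → S //
          ¬ 0 < X.P (a ⟨n, by omega⟩) (a ⟨n + 1, by omega⟩)},
        {ω | ∀ k ≤ n + 1, ω k = a.1 (Fin.ofNat (n + 2) k)} := by
    intro ω hω
    refine mem_iUnion.2 ⟨⟨fun k => ω k, hω⟩, fun k hk => ?_⟩
    simp [Nat.mod_eq_of_lt (show k < n + 2 by omega)]
  refine measure_mono_null hsub (measure_iUnion_null fun a => ?_)
  rw [X.μ_cylinder (n + 1) fun k => a.1 (Fin.ofNat (n + 2) k)]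
  have hz : X.P (a.1 (Fin.ofNat (n + 2) n)) (a.1 (Fin.ofNat (n + 2) (n + 1))) = 0 := by
    have h₁ : Fin.ofNat (n + 2) n = ⟨n, by omega⟩ := by
      ext; simp
    have h₂ : Fin.ofNat (n + 2) (n + 1) = ⟨n + 1, by omega⟩ := by
      ext; simp
    rw [h₁, h₂]
    exact le_antisymm (not_lt.1 a.2) (X.P_nonneg _ _)
  rw [Finset.prod_eq_zero (Finset.mem_range.2 (Nat.lt_succ_self n)) hz, mul_zero,
    ENNReal.ofReal_zero]

/-- The probability, starting from a state, of spending the next `n` steps in `F`. -/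
noncomputable def stayProb (F : Finset S) : ℕ → S → ℝ
  | 0, _ => 1
  | n + 1, i => ∑ j ∈ F, X.P i j * stayProb F n j

theorem stayProb_nonneg (F : Finset S) (n : ℕ) (i : S) : 0 ≤ X.stayProb F n i := by
  induction n generalizing i with
  | zero => exact zero_le_one
  | succ n ih => exact Finset.sum_nonneg fun j _ => mul_nonneg (X.P_nonneg i j) (ih j)

theorem sum_P_le_one (F : Finset S) (i : S) : ∑ j ∈ F, X.P i j ≤ 1 :=
  sum_le_hasSum F (fun j _ => X.P_nonneg i j) (X.P_stochastic i)

theorem stayProb_succ_le (F : Finset S) (n : ℕ) (i : S) :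
    X.stayProb F (n + 1) i ≤ X.stayProb F n i := by
  induction n generalizing i with
  | zero => simpa [stayProb] using X.sum_P_le_one F i
  | succ n ih =>
    rw [stayProb, stayProb]
    exact Finset.sum_le_sum fun j _ => mul_le_mul_of_nonneg_left (ih j) (X.P_nonneg i j)

theorem measure_cylinder_stay_le (F : Finset S) (m n : ℕ) (s : ℕ → S) :
    X.μ {ω | (∀ k ≤ n, ω k = s k) ∧ ∀ k, n ≤ k → ω k ∈ F} ≤
      ENNReal.ofReal ((X.init (s 0) * ∏ k ∈ Finset.range n, X.P (s k) (s (k + 1))) *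
        X.stayProb F m (s n)) := by
  induction m generalizing n s with
  | zero =>
    rw [stayProb, mul_one, ← X.μ_cylinder]
    exact measure_mono fun ω hω => hω.1
  | succ m ih =>
    classical
    have hsub : {ω : ℕ → S | (∀ k ≤ n, ω k = s k) ∧ ∀ k, n ≤ k → ω k ∈ F} ⊆
        ⋃ j ∈ F, {ω | (∀ k ≤ n + 1, ω k = Function.update s (n + 1) j k) ∧
          ∀ k, n + 1 ≤ k → ω k ∈ F} := by
      rintro ω ⟨h₁, h₂⟩
      refine mem_iUnion₂.2 ⟨ω (n + 1), h₂ _ (Nat.le_succ n), fun k hk => ?_,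
        fun k hk => h₂ k (by omega)⟩
      rcases hk.eq_or_lt with rfl | hk'
      · simp
      · rw [Function.update_of_ne hk'.ne, h₁ k (by omega)]
    refine (measure_mono hsub).trans ((measure_biUnion_finset_le _ _).trans
      ((Finset.sum_le_sum fun j _ => ih (n + 1) (Function.update s (n + 1) j)).trans ?_))
    have hprod : ∀ j, ∏ k ∈ Finset.range (n + 1),
        X.P (Function.update s (n + 1) j k) (Function.update s (n + 1) j (k + 1)) =
        (∏ k ∈ Finset.range n, X.P (s k) (s (k + 1))) * X.P (s n) j := by
      intro j
      rw [Finset.prod_range_succ]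
      congr 1
      · refine Finset.prod_congr rfl fun k hk => ?_
        have := Finset.mem_range.1 hk
        rw [Function.update_of_ne (by omega), Function.update_of_ne (by omega)]
      · rw [Function.update_of_ne (by omega), Function.update_self]
    have hc : 0 ≤ X.init (s 0) * ∏ k ∈ Finset.range n, X.P (s k) (s (k + 1)) :=
      mul_nonneg (X.init_nonneg _) (Finset.prod_nonneg fun k _ => X.P_nonneg _ _)
    rw [← ENNReal.ofReal_sum_of_nonneg fun j _ => mul_nonneg
      (mul_nonneg (X.init_nonneg _) (Finset.prod_nonneg fun k _ => X.P_nonneg _ _))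
      (X.stayProb_nonneg F m _)]
    refine le_of_eq (congrArg _ ?_)
    rw [stayProb, Finset.mul_sum]
    refine Finset.sum_congr rfl fun j _ => ?_
    rw [hprod, Function.update_self, Function.update_of_ne (by omega)]
    ring

/-- An irreducible chain leaves every finite proper subset of the state space. -/
theorem tendsto_stayProb {X : MarkovChain S} (hirr : X.Irreducible) (F : Finset S) {z : S}
    (hz : z ∉ F) {i : S} (hi : i ∈ F) : Tendsto (fun n => X.stayProb F n i) atTop (nhds 0) := by
  set f : S → ℝ := fun i => ⨅ n, X.stayProb F n i
  have hf : ∀ i, Tendsto (fun n => X.stayProb F n i) atTop (nhds (f i)) := fun i =>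
    tendsto_atTop_ciInf (antitone_nat_of_succ_le fun n => X.stayProb_succ_le F n i)
      ⟨0, forall_mem_range.2 fun n => X.stayProb_nonneg F n i⟩
  have hf_nonneg : ∀ i, 0 ≤ f i := fun i => le_ciInf fun n => X.stayProb_nonneg F n i
  have hf_eq : ∀ i, f i = ∑ j ∈ F, X.P i j * f j := fun i =>
    tendsto_nhds_unique ((hf i).comp (tendsto_add_atTop_nat 1))
      (tendsto_finsetSum _ fun j _ => (hf j).const_mul (X.P i j))
  obtain ⟨x, hxF, hx⟩ := F.exists_max_image f ⟨i, hi⟩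
  suffices h : f x = 0 by
    have : f i = 0 := le_antisymm (h ▸ hx i hi) (hf_nonneg i)
    simpa [this] using hf i
  by_contra h0
  have hpos : 0 < f x := (hf_nonneg x).lt_of_ne' h0
  have step : ∀ a b, (a ∈ F ∧ f a = f x) → 0 < X.P a b → b ∈ F ∧ f b = f x := by
    rintro a b ⟨-, ha⟩ hab
    by_contra hb
    have hle : ∑ j ∈ F, X.P a j * f j ≤ ∑ j ∈ F, X.P a j * f x :=
      Finset.sum_le_sum fun j hj => mul_le_mul_of_nonneg_left (hx j hj) (X.P_nonneg a j)
    rw [← Finset.sum_mul, ← hf_eq, ha] at hle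
    by_cases hbF : b ∈ F
    · have hlt : ∑ j ∈ F, X.P a j * f j < ∑ j ∈ F, X.P a j * f x :=
        Finset.sum_lt_sum
          (fun j hj => mul_le_mul_of_nonneg_left (hx j hj) (X.P_nonneg a j))
          ⟨b, hbF, mul_lt_mul_of_pos_left ((hx b hbF).lt_of_ne fun h => hb ⟨hbF, h⟩) hab⟩
      rw [← Finset.sum_mul, ← hf_eq, ha] at hlt
      nlinarith [X.sum_P_le_one F a]
    · have h1 := X.sum_P_le_one (F.cons b hbF) a
      rw [Finset.sum_cons] at h1
      nlinarith
  obtain ⟨n, hn⟩ := hirr x z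
  exact hz (of_Pn_pos step ⟨hxF, rfl⟩ hn).1

/-- Almost every path of an irreducible chain leaves a given finite proper subset. -/
theorem ae_exists_notMem {X : MarkovChain S} (hirr : X.Irreducible) (F : Finset S) {z : S}
    (hz : z ∉ F) : ∀ᵐ ω ∂X.μ, ∃ k, ω k ∉ F := by
  rw [ae_iff]
  have hsub : {ω : ℕ → S | ¬ ∃ k, ω k ∉ F} ⊆
      ⋃ i ∈ F, {ω | (∀ k ≤ 0, ω k = i) ∧ ∀ k, 0 ≤ k → ω k ∈ F} := by
    intro ω hω
    simp only [not_exists, not_not, mem_ofPred_eq] at hω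
    refine mem_iUnion₂.2 ⟨ω 0, hω 0, fun k hk => ?_, fun k _ => hω k⟩
    rw [Nat.le_zero.1 hk]
  refine measure_mono_null hsub ((measure_biUnion_null_iff F.countable_toSet).2 fun i hi => ?_)
  refine le_antisymm (ge_of_tendsto' (f := fun m => ENNReal.ofReal (X.init i * X.stayProb F m i))
    (x := atTop) ?_ fun m => ?_) zero_le
  · have := ENNReal.tendsto_ofReal ((tendsto_stayProb hirr F hz hi).const_mul (X.init i))
    simpa using this
  · simpa using X.measure_cylinder_stay_le F m 0 fun _ => i

end General

/-- If an unbounded path with upward jumps at most `M` is eventually in `C`, then `C` meets all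
sufficiently far windows of length `M`. -/
theorem exists_window_of_path {ω : ℕ → ℕ} {M : ℕ} {C : Set ℕ}
    (hjump : ∀ k, ω (k + 1) ≤ ω k + M) (hunb : ∀ B, ∃ k, B < ω k)
    (hC : ∀ᶠ k in atTop, ω k ∈ C) :
    ∃ N, ∀ n, N ≤ n → ∃ j ∈ C, n ≤ j ∧ j < n + M := by
  classical
  obtain ⟨K, hK⟩ := eventually_atTop.1 hC
  refine ⟨(Finset.range (K + 1)).sup ω + 1, fun n hn => ?_⟩
  have hex : ∃ k, n ≤ ω k := (hunb n).imp fun _ => le_of_lt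
  have hsmall : ∀ k ≤ K, ω k < n := fun k hk =>
    (Nat.lt_succ_of_le (Finset.le_sup (f := ω) (Finset.mem_range.2 (by omega)))).trans_le hn
  have hbig : K < Nat.find hex := by
    by_contra! h
    exact absurd (Nat.find_spec hex) (not_le.2 (hsmall _ h))
  refine ⟨ω (Nat.find hex), hK _ hbig.le, Nat.find_spec hex, ?_⟩
  obtain ⟨t, ht⟩ : ∃ t, Nat.find hex = t + 1 := ⟨Nat.find hex - 1, by omega⟩
  have h1 : ω t < n := not_le.1 (Nat.find_min hex (by omega))
  rw [ht]
  have := hjump t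
  omega

variable {X : MarkovChain ℕ} {M : ℕ}

theorem AlmostClosed.exists_window (hirr : X.Irreducible)
    (hjump : ∀ i j : ℕ, (M : ℤ) < |(i : ℤ) - (j : ℤ)| → X.P i j = 0)
    {C : Set ℕ} (hC : X.AlmostClosed 1 C) :
    ∃ N, ∀ n, N ≤ n → ∃ j ∈ C, n ≤ j ∧ j < n + M := by
  have hunb : ∀ᵐ ω ∂X.μ, ∀ B, ∃ k, B < ω k := by
    rw [ae_all_iff]
    intro B
    filter_upwards [ae_exists_notMem hirr (Finset.range (B + 1)) (z := B + 1) (by simp)] with ω hω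
    obtain ⟨k, hk⟩ := hω
    exact ⟨k, not_le.1 fun h => hk (Finset.mem_range_succ_iff.2 h)⟩
  have hfreq : ∃ᵐ ω ∂X.μ, ∃ᶠ k in atTop, ω k ∈ C := fun h =>
    hC.2 ((X.transient_one_iff).2 (h.mono fun ω hω => not_frequently.1 hω))
  obtain ⟨ω, hU, hunb, hP, hreg⟩ := (hfreq.and_eventually
    (hunb.and (X.ae_forall_P_pos.and ((X.regular_one_iff).1 hC.1)))).exists
  refine exists_window_of_path (fun k => ?_) hunb (hreg hU)
  by_contra! hk
  refine (hP k).ne' (hjump _ _ (lt_abs.2 (Or.inr ?_)))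
  omega

/-- The number of pairwise disjoint almost closed sets is at most the jump bound. -/
theorem card_le_of_pairwiseDisjoint_almostClosed (hirr : X.Irreducible)
    (hjump : ∀ i j : ℕ, (M : ℤ) < |(i : ℤ) - (j : ℤ)| → X.P i j = 0)
    {𝒟 : Finset (Set ℕ)} (hac : ∀ C ∈ 𝒟, X.AlmostClosed 1 C)
    (hdisj : (𝒟 : Set (Set ℕ)).PairwiseDisjoint id) : 𝒟.card ≤ M := by
  have hw : ∀ C, ∃ N, C ∈ 𝒟 → ∀ n, N ≤ n → ∃ j ∈ C, n ≤ j ∧ j < n + M := fun C => by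
    by_cases hC : C ∈ 𝒟
    · exact ((hac C hC).exists_window hirr hjump).imp fun _ h _ => h
    · exact ⟨0, fun h => absurd h hC⟩
  choose N hN using hw
  have hj : ∀ C, ∃ j, C ∈ 𝒟 → j ∈ C ∧ 𝒟.sup N ≤ j ∧ j < 𝒟.sup N + M := fun C => by
    by_cases hC : C ∈ 𝒟
    · exact (hN C hC _ (Finset.le_sup hC)).imp fun _ h _ => h
    · exact ⟨0, fun h => absurd h hC⟩
  choose g hg using hj
  have hcard : 𝒟.card ≤ (Finset.Ico (𝒟.sup N) (𝒟.sup N + M)).card := by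
    refine Finset.card_le_card_of_injOn g (fun C hC => ?_) fun A hA B hB hAB => ?_
    · simpa using (hg C hC).2
    · exact hdisj.elim_set hA hB (g A) (hg A hA).1 (hAB ▸ (hg B hB).1)
  simpa using hcard

theorem pairwiseDisjoint_insert_card {S : Type} [MeasurableSpace S] [DecidableEq (Set S)]
    {X : MarkovChain S} {m : ℕ}
    {𝒟 : Finset (Set S)} {A : Set S} (hA : X.AlmostClosed m A)
    (hac : ∀ C ∈ 𝒟, X.AlmostClosed m C) (hdisj : (𝒟 : Set (Set S)).PairwiseDisjoint id)
    (h : ∀ C ∈ 𝒟, Disjoint A C) :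
    (∀ C ∈ insert A 𝒟, X.AlmostClosed m C) ∧
      ((insert A 𝒟 : Finset (Set S)) : Set (Set S)).PairwiseDisjoint id ∧
      (insert A 𝒟).card = 𝒟.card + 1 := by
  refine ⟨by simpa using ⟨hA, hac⟩, ?_, Finset.card_insert_of_notMem fun hmem => ?_⟩
  · rw [Finset.coe_insert]
    exact hdisj.insert fun C hC _ => h C hC
  · exact hA.nonempty.ne_empty (disjoint_self.1 (h A hmem))

/-- An almost closed set without atomic subsets contains arbitrarily many disjoint almost
closed sets. -/
theorem exists_disjoint_almostClosed_of_forall_not_atomic {S : Type} [MeasurableSpace S]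
    {X : MarkovChain S} {m : ℕ} (n : ℕ) {C : Set S} (hC : X.AlmostClosed m C)
    (hna : ∀ A ⊆ C, ¬ X.Atomic m A) :
    ∃ 𝒟 : Finset (Set S), (∀ D ∈ 𝒟, D ⊆ C) ∧ (∀ D ∈ 𝒟, X.AlmostClosed m D) ∧
      (𝒟 : Set (Set S)).PairwiseDisjoint id ∧ 𝒟.card = n := by
  classical
  induction n generalizing C with
  | zero => exact ⟨∅, by simp⟩
  | succ n ih =>
    have := hna C subset_rfl
    rw [Atomic, not_and, not_not] at this
    obtain ⟨A, B, hAC, hBC, hAB, hA, hB⟩ := this hC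
    obtain ⟨𝒟, hsub, hac, hdisj, hcard⟩ := ih hB fun D hD => hna D (hD.trans hBC)
    obtain ⟨h1, h2, h3⟩ := pairwiseDisjoint_insert_card hA hac hdisj
      fun D hD => hAB.mono_right (hsub D hD)
    refine ⟨insert A 𝒟, ?_, h1, h2, by rw [h3, hcard]⟩
    simpa using ⟨hAC, fun D hD => (hsub D hD).trans hBC⟩

/-- A family of disjoint almost closed sets of maximal finite size is a Blackwell
decomposition. -/
theorem isBlackwell_of_maximal {S : Type} [MeasurableSpace S] [DiscreteMeasurableSpace S]
    {X : MarkovChain S} {𝒟 : Finset (Set S)} (hac : ∀ C ∈ 𝒟, X.AlmostClosed 1 C)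
    (hdisj : (𝒟 : Set (Set S)).PairwiseDisjoint id)
    (hmax : ∀ ℰ : Finset (Set S), (∀ C ∈ ℰ, X.AlmostClosed 1 C) →
      (ℰ : Set (Set S)).PairwiseDisjoint id → ℰ.card ≤ 𝒟.card) :
    X.IsBlackwell 1 (𝒟 : Set (Set S)) := by
  classical
  have := X.μ_prob
  have hatom : ∀ C ∈ 𝒟, X.Atomic 1 C := by
    rintro C hC
    refine ⟨hac C hC, ?_⟩
    rintro ⟨A, B, hAC, hBC, hAB, hA, hB⟩
    have hE : ∀ D ∈ 𝒟.erase C, Disjoint C D := fun D hD =>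
      hdisj hC (Finset.mem_of_mem_erase hD) (Finset.ne_of_mem_erase hD).symm
    obtain ⟨h1, h2, h3⟩ := pairwiseDisjoint_insert_card (𝒟 := 𝒟.erase C) hB
      (fun D hD => hac D (Finset.mem_of_mem_erase hD))
      (hdisj.subset (Finset.coe_subset.2 (Finset.erase_subset _ _)))
      fun D hD => (hE D hD).mono_left hBC
    obtain ⟨h4, h5, h6⟩ := pairwiseDisjoint_insert_card hA h1 h2 (by
      simpa using ⟨hAB, fun D h₁ h₂ => (hE D (Finset.mem_erase.2 ⟨h₁, h₂⟩)).mono_left hAC⟩)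
    have := hmax _ h4 h5
    have := Finset.card_erase_add_one hC
    omega
  have hreg : ∀ᵐ ω ∂X.μ, ∀ C ∈ 𝒟, (∃ᶠ k in atTop, ω k ∈ C) → ∀ᶠ k in atTop, ω k ∈ C :=
    (Finset.eventually_all 𝒟).2 fun C hC => (X.regular_one_iff).1 (hac C hC).1
  have hev : ∀ ω : ℕ → S,
      (∀ C ∈ 𝒟, (∃ᶠ k in atTop, ω k ∈ C) → ∀ᶠ k in atTop, ω k ∈ C) →
      (∃ᶠ k in atTop, ω k ∈ ⋃ C ∈ 𝒟, C) → ∃ C ∈ 𝒟, ∀ᶠ k in atTop, ω k ∈ C := by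
    intro ω hω hf
    by_contra hne
    refine hf ?_
    have : ∀ᶠ k in atTop, ∀ C ∈ 𝒟, ω k ∉ C :=
      (Finset.eventually_all 𝒟).2 fun C hC =>
        not_frequently.1 fun h => hne ⟨C, hC, hω C hC h⟩
    filter_upwards [this] with k hk
    simpa using hk
  have hcompl : X.Transient 1 (⋃ C ∈ 𝒟, C)ᶜ := by
    by_contra hnt
    have hD : X.AlmostClosed 1 (⋃ C ∈ 𝒟, C)ᶜ := by
      refine ⟨(X.regular_one_iff).2 ?_, hnt⟩
      filter_upwards [hreg] with ω hω hf
      by_contra hne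
      have hne' : ∃ᶠ k in atTop, ω k ∈ ⋃ C ∈ 𝒟, C := by
        simpa [Filter.Frequently] using hne
      obtain ⟨C, hC, hCe⟩ := hev ω hω hne'
      exact hf (hCe.mono fun k hk => not_not.2 (mem_iUnion₂.2 ⟨C, hC, hk⟩))
    obtain ⟨h1, h2, h3⟩ := pairwiseDisjoint_insert_card hD hac hdisj fun C hC =>
      (disjoint_compl_right.mono_left (subset_iUnion₂_of_subset C hC subset_rfl)).symm
    have := hmax _ h1 h2
    omega
  have hcover : ∀ᵐ ω ∂X.μ, ω ∈ ⋃ C : (𝒟 : Set (Set S)), X.L 1 (C : Set S) := by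
    filter_upwards [hreg, (X.transient_one_iff).1 hcompl] with ω hω ht
    have hin : ∀ᶠ k in atTop, ω k ∈ ⋃ C ∈ 𝒟, C := ht.mono fun k hk => not_not.1 hk
    obtain ⟨C, hC, hCe⟩ := hev ω hω hin.frequently
    exact mem_iUnion.2 ⟨⟨C, hC⟩, (X.mem_L_one).2 hCe⟩
  refine ⟨𝒟.countable_toSet, hac, hdisj, fun C hC _ _ h => absurd (hatom C hC) h,
    fun C hC h => absurd (hatom C hC) h, fun C hC h => absurd (hatom C hC) h, ?_⟩
  rw [← measure_iUnion _ fun C => X.measurableSet_L MeasurableSet.of_discrete 1]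
  · exact (measure_congr (eventuallyEq_univ.2 hcover)).trans measure_univ
  intro A B hAB
  refine Set.disjoint_left.2 fun ω hA hB => ?_
  obtain ⟨k, hkA, hkB⟩ := (((X.mem_L_one).1 hA).and ((X.mem_L_one).1 hB)).exists
  exact Set.disjoint_left.1 (hdisj A.2 B.2 fun h => hAB (Subtype.ext h)) hkA hkB

end MarkovChain

/-- If `S = ℕ` and the jumps of `X` are uniformly bounded by `M ≥ 1`
(i.e. `P(i,j) = 0` whenever `|i - j| > M`), then `β(X) ≤ M` and every set in the
Blackwell decomposition for `X` is atomic. -/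
theorem stmt0 (X : MarkovChain ℕ) (hirr : X.Irreducible) (hap : X.Aperiodic)
    (M : ℕ) (hM : 1 ≤ M)
    (hjump : ∀ i j : ℕ, (M : ℤ) < |(i : ℤ) - (j : ℤ)| → X.P i j = 0) :
    X.beta 1 ≤ (M : ℕ∞) ∧
      ∀ 𝒞 : Set (Set ℕ), X.IsBlackwell 1 𝒞 → ∀ C ∈ 𝒞, X.Atomic 1 C := by
  classical
  have hbound := fun (𝒟 : Finset (Set ℕ)) (hac : ∀ C ∈ 𝒟, X.AlmostClosed 1 C) hdisj =>
    MarkovChain.card_le_of_pairwiseDisjoint_almostClosed hirr hjump hac hdisj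
  refine ⟨?_, fun 𝒞 h𝒞 C hC => ?_⟩
  · let s : Set ℕ := {n | ∃ 𝒟 : Finset (Set ℕ), (∀ C ∈ 𝒟, X.AlmostClosed 1 C) ∧
      (𝒟 : Set (Set ℕ)).PairwiseDisjoint id ∧ 𝒟.card = n}
    have hbdd : BddAbove s := ⟨M, by rintro _ ⟨𝒟, hac, hdisj, rfl⟩; exact hbound 𝒟 hac hdisj⟩
    obtain ⟨𝒟, hac, hdisj, hcard⟩ : sSup s ∈ s :=
      Nat.sSup_mem (s := s) ⟨0, ∅, by simp⟩ hbdd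
    have hB : X.IsBlackwell 1 (𝒟 : Set (Set ℕ)) :=
      MarkovChain.isBlackwell_of_maximal hac hdisj fun ℰ h₁ h₂ =>
        hcard ▸ le_csSup hbdd (show ℰ.card ∈ s from ⟨ℰ, h₁, h₂, rfl⟩)
    refine (sInf_le (mem_image_of_mem Set.encard hB)).trans ?_
    rw [Set.encard_coe_eq_coe_finsetCard]
    exact_mod_cast hbound 𝒟 hac hdisj
  · by_contra hna
    obtain ⟨𝒟, -, hac, hdisj, hcard⟩ :=
      MarkovChain.exists_disjoint_almostClosed_of_forall_not_atomic (M + 1)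
        (h𝒞.almostClosed C hC) (h𝒞.nonatomicNoAtomicSubset C hC hna)
    have := hbound 𝒟 hac hdisj
    omega
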